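/- Let n ≥ 3 be an integer and let s be a real number with (n−1)/n < s < (n−1)/(n−2). Let x, y : [0,∞) → ℝ be a twice continuously differentiable solution of the system (S_s) with zero initial data defined for all t ≥ 0. Then the limit lim_{t→∞} (x(t) − y(t)) exists and is a finite real number. -/

import Mathlib

open Real Set Filter

/-- The ODE system (S_s):
`x'' = n − (1/s)(n−1)e^{−2x} − (n/2)((x')² + x'·y')` and
`y'' = n − (2 − 1/s)(n−1)e^{−2y} − (n/2)((y')² + x'·y')`, required at all points of `I`. -/
def SysS (n : ℕ) (s : ℝ) (x y : ℝ → ℝ) (I : Set ℝ) : Prop :=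
  ∀ t ∈ I,
    deriv (deriv x) t =
      (n : ℝ) - (1 / s) * ((n : ℝ) - 1) * Real.exp (-2 * x t)
        - ((n : ℝ) / 2) * ((deriv x t) ^ 2 + deriv x t * deriv y t) ∧
    deriv (deriv y) t =
      (n : ℝ) - (2 - 1 / s) * ((n : ℝ) - 1) * Real.exp (-2 * y t)
        - ((n : ℝ) / 2) * ((deriv y t) ^ 2 + deriv x t * deriv y t)

/-- Zero initial data: `x(0) = y(0) = x'(0) = y'(0) = 0`. -/
def ZeroInit (x y : ℝ → ℝ) : Prop :=
  x 0 = 0 ∧ y 0 = 0 ∧ deriv x 0 = 0 ∧ deriv y 0 = 0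



/-- Monotonicity helper. -/
lemma aux_mono (f f' : ℝ → ℝ) (a b : ℝ) (hab : a ≤ b) (hc : ContinuousOn f (Icc a b))
    (hd : ∀ t ∈ Ioo a b, HasDerivAt f (f' t) t) (hp : ∀ t ∈ Ioo a b, 0 ≤ f' t) : f a ≤ f b := by
  have hm : MonotoneOn f (Icc a b) := by
    apply monotoneOn_of_deriv_nonneg (convex_Icc a b) hc
    · intro t ht
      rw [interior_Icc] at ht
      exact (hd t ht).differentiableAt.differentiableWithinAt
    · intro t ht
      rw [interior_Icc] at ht
      rw [(hd t ht).deriv]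
      exact hp t ht
  exact hm (left_mem_Icc.2 hab) (right_mem_Icc.2 hab) hab

/-- Regularity from the hypotheses: `x` and `deriv x` behave well on `[0,∞)`. -/
lemma aux_reg (x : ℝ → ℝ) (hx : ContDiffOn ℝ 2 x (Ici (0 : ℝ)))
    (h0 : deriv (deriv x) 0 ≠ 0) :
    ContinuousOn x (Ici 0) ∧ ContinuousOn (deriv x) (Ici 0) ∧
    (∀ t, 0 < t → HasDerivAt x (deriv x t) t) ∧
    (∀ t, 0 < t → HasDerivAt (deriv x) (deriv (deriv x) t) t) := by
  have h1 : ∀ t, 0 < t → ContDiffAt ℝ 2 x t := fun t ht => hx.contDiffAt (Ici_mem_nhds ht)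
  have h2 : ∀ t, 0 < t → HasDerivAt (deriv x) (deriv (deriv x) t) t := by
    intro t ht
    have h3 : ContDiffAt ℝ 1 (deriv x) t := by
      have h4 : ContDiffOn ℝ 2 x (Ioi 0) := hx.mono Ioi_subset_Ici_self
      have h5 : ContDiffOn ℝ 1 (deriv x) (Ioi 0) :=
        h4.deriv_of_isOpen isOpen_Ioi (by norm_num)
      exact h5.contDiffAt (Ioi_mem_nhds ht)
    exact (h3.differentiableAt (by norm_num)).hasDerivAt
  refine ⟨hx.continuousOn, ?_, fun t ht => ((h1 t ht).differentiableAt (by norm_num)).hasDerivAt, h2⟩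
  intro t ht
  rcases eq_or_lt_of_le (mem_Ici.1 ht) with h | h
  · subst h
    exact (differentiableAt_of_deriv_ne_zero h0).continuousAt.continuousWithinAt
  · exact (h2 t h).continuousAt.continuousWithinAt

/-- Derivative of the integrating factor times a function. -/
lemma aux_E (N : ℝ) (x y f : ℝ → ℝ) (p q f' t : ℝ) (hx : HasDerivAt x p t)
    (hy : HasDerivAt y q t) (hf : HasDerivAt f f' t) :
    HasDerivAt (fun t => Real.exp (N / 2 * (x t + y t)) * f t)
      (Real.exp (N / 2 * (x t + y t)) * (f' + N / 2 * (p + q) * f t)) t := by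
  have h := (((hx.add hy).const_mul (N / 2)).exp).mul hf
  refine h.congr_deriv ?_
  simp only [Pi.add_apply]
  ring

/-- Nonnegativity of `x` and `x'`. -/
lemma aux_nonneg (N a : ℝ) (x y p q : ℝ → ℝ) (ha : 0 < a) (haN : a < N)
    (hxc : ContinuousOn x (Ici 0)) (hyc : ContinuousOn y (Ici 0))
    (hpc : ContinuousOn p (Ici 0))
    (hx : ∀ t, 0 < t → HasDerivAt x (p t) t) (hy : ∀ t, 0 < t → HasDerivAt y (q t) t)
    (hp : ∀ t, 0 < t →
      HasDerivAt p (N - a * Real.exp (-2 * x t) - N / 2 * (p t ^ 2 + p t * q t)) t)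
    (x0 : x 0 = 0) (p0 : p 0 = 0) : ∀ t, 0 ≤ t → 0 ≤ x t ∧ 0 ≤ p t := by
  -- conditional statement
  have key : ∀ T, 0 ≤ T → (∀ t, 0 < t → t < T → a * Real.exp (-2 * x t) ≤ N) →
      0 ≤ x T ∧ 0 ≤ p T := by
    intro T hT hlt
    have hP : ∀ t, 0 ≤ t → t ≤ T → 0 ≤ p t := by
      intro t ht htT
      have h := aux_mono (fun t => Real.exp (N / 2 * (x t + y t)) * p t)
        (fun t => Real.exp (N / 2 * (x t + y t)) *
          ((N - a * Real.exp (-2 * x t) - N / 2 * (p t ^ 2 + p t * q t))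
            + N / 2 * (p t + q t) * p t)) 0 t ht ?_ ?_ ?_
      · simp only [p0, mul_zero] at h
        exact nonneg_of_mul_nonneg_right h (Real.exp_pos _)
      · have hs : Icc 0 t ⊆ Ici (0:ℝ) := Icc_subset_Ici_self
        exact ((continuousOn_const.mul ((hxc.mono hs).add (hyc.mono hs))).rexp).mul (hpc.mono hs)
      · intro r hr
        exact aux_E N x y p _ _ _ r (hx r hr.1) (hy r hr.1) (hp r hr.1)
      · intro r hr
        apply mul_nonneg (Real.exp_pos _).le
        have := hlt r hr.1 (hr.2.trans_le htT)
        nlinarith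
    refine ⟨?_, hP T hT le_rfl⟩
    have h := aux_mono x p 0 T hT (hxc.mono Icc_subset_Ici_self) (fun t ht => hx t ht.1)
      (fun t ht => hP t ht.1.le ht.2.le)
    rwa [x0] at h
  suffices H : ∀ t, 0 ≤ t → a * Real.exp (-2 * x t) < N by
    intro t ht
    exact key t ht (fun r hr _ => (H r hr.le).le)
  by_contra! hcon
  obtain ⟨t1, ht1, hbad⟩ := hcon
  let S : Set ℝ := Icc 0 t1 ∩ (fun t => a * Real.exp (-2 * x t)) ⁻¹' Ici N
  have hcl : IsClosed S := by
    apply ContinuousOn.preimage_isClosed_of_isClosed _ isClosed_Icc isClosed_Ici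
    have hs : Icc 0 t1 ⊆ Ici (0:ℝ) := Icc_subset_Ici_self
    exact continuousOn_const.mul ((continuousOn_const.mul (hxc.mono hs)).rexp)
  have hne : S.Nonempty := ⟨t1, ⟨ht1, le_rfl⟩, hbad⟩
  have hbb : BddBelow S := ⟨0, fun t ht => ht.1.1⟩
  have hmem := hcl.csInf_mem hne hbb
  have h1 := (key (sInf S) hmem.1.1 (by
    intro t ht htT
    by_contra! hc
    have : t ∈ S := ⟨⟨ht.le, htT.le.trans hmem.1.2⟩, hc.le⟩
    exact absurd (csInf_le hbb this) (not_le.2 htT))).1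
  have h2 : N ≤ a * Real.exp (-2 * x (sInf S)) := hmem.2
  have h3 : Real.exp (-2 * x (sInf S)) ≤ 1 := Real.exp_le_one_iff.2 (by linarith)
  nlinarith

/-- Lower bound for `x'` and `x` for `t ≥ 1`. -/
lemma aux_lower (N a c : ℝ) (x p q : ℝ → ℝ) (hN : 3 ≤ N) (ha : 0 < a) (haN : a < N)
    (hc : c * (2 * N) ≤ N - a)
    (hxc : ContinuousOn x (Ici 0)) (hpc : ContinuousOn p (Ici 0))
    (hx : ∀ t, 0 < t → HasDerivAt x (p t) t)
    (hp : ∀ t, 0 < t →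
      HasDerivAt p (N - a * Real.exp (-2 * x t) - N / 2 * (p t ^ 2 + p t * q t)) t)
    (hx0 : ∀ t, 0 ≤ t → 0 ≤ x t) (hp0 : ∀ t, 0 ≤ t → 0 ≤ p t)
    (hw : ∀ t, 0 ≤ t → p t + q t ≤ 2) (p0 : p 0 = 0) :
    ∀ t, 1 ≤ t → c ≤ p t ∧ c * (t - 1) ≤ x t := by
  have hpl : ∀ t, 1 ≤ t → c ≤ p t := by
    intro t ht
    have h := aux_mono (fun t => Real.exp (N * t) * (p t - (N - a) / N))
      (fun t => Real.exp (N * t) *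
        ((N - a * Real.exp (-2 * x t) - N / 2 * (p t ^ 2 + p t * q t))
          + N * (p t - (N - a) / N))) 0 t (by linarith) ?_ ?_ ?_
    · simp only [mul_zero, Real.exp_zero, p0] at h
      have he : 2 ≤ Real.exp (N * t) := by
        have := Real.add_one_le_exp (N * t)
        nlinarith
      have hm : 2 * c ≤ (N - a) / N := by
        rw [le_div_iff₀ (by linarith)]; linarith
      have hm0 : 0 < (N - a) / N := div_pos (by linarith) (by linarith)
      generalize (N - a) / N = m at *
      generalize Real.exp (N * t) = e at *
      by_contra! hlt
      nlinarith
    · have hs : Icc 0 t ⊆ Ici (0:ℝ) := Icc_subset_Ici_self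
      exact ((continuousOn_const.mul continuousOn_id).rexp).mul
        ((hpc.mono hs).sub continuousOn_const)
    · intro r hr
      have h := (((hasDerivAt_id r).const_mul N).exp).mul ((hp r hr.1).sub_const ((N - a) / N))
      refine h.congr_deriv ?_
      simp only [id]
      ring
    · intro r hr
      apply mul_nonneg (Real.exp_pos _).le
      have h1 : N * (p r - (N - a) / N) = N * p r - (N - a) := by
        have : N ≠ 0 := by linarith
        field_simp
      rw [h1]
      have h3 : Real.exp (-2 * x r) ≤ 1 :=
        Real.exp_le_one_iff.2 (by linarith [hx0 r hr.1.le])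
      have h4 : 0 ≤ N * (p r * (2 - (p r + q r))) :=
        mul_nonneg (by linarith) (mul_nonneg (hp0 r hr.1.le) (by linarith [hw r hr.1.le]))
      nlinarith
  intro t ht
  refine ⟨hpl t ht, ?_⟩
  have h := aux_mono (fun t => x t - c * (t - 1)) (fun t => p t - c) 1 t ht ?_ ?_ ?_
  · have := hx0 1 (by norm_num)
    linarith
  · have hs : Icc 1 t ⊆ Ici (0:ℝ) := fun r hr => le_trans (by norm_num) hr.1
    exact (hxc.mono hs).sub (by fun_prop)
  · intro r hr
    have h := (hx r (by linarith [hr.1])).sub (((hasDerivAt_id r).sub_const 1).const_mul c)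
    exact h.congr_deriv (by ring)
  · intro r hr
    linarith [hpl r hr.1.le]

/-- One-sided exponential decay of `p - q`. -/
lemma aux_decay (N a b c : ℝ) (x y p q : ℝ → ℝ) (hN : 3 ≤ N) (ha : 0 < a)
    (hb : 0 < b) (hbN : b < N) (hc : 0 < c)
    (hx : ∀ t, 0 < t → HasDerivAt x (p t) t) (hy : ∀ t, 0 < t → HasDerivAt y (q t) t)
    (hp : ∀ t, 0 < t →
      HasDerivAt p (N - a * Real.exp (-2 * x t) - N / 2 * (p t ^ 2 + p t * q t)) t)
    (hq : ∀ t, 0 < t →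
      HasDerivAt q (N - b * Real.exp (-2 * y t) - N / 2 * (q t ^ 2 + p t * q t)) t)
    (hpl : ∀ t, 1 ≤ t → c ≤ p t) (hql : ∀ t, 1 ≤ t → c ≤ q t)
    (hyl : ∀ t, 1 ≤ t → c * (t - 1) ≤ y t) (K : ℝ) (hK : N ≤ K * c) (hK1 : p 1 - q 1 ≤ K) :
    ∀ t, 1 ≤ t → p t - q t ≤ K * Real.exp (-2 * c * (t - 1)) := by
  intro t ht
  have hd : ∀ r, 0 < r → HasDerivAt
      (fun t => Real.exp (N / 2 * (x t + y t)) * (K * Real.exp (-2 * c * (t - 1)) - (p t - q t)))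
      (Real.exp (N / 2 * (x r + y r)) *
        ((-2 * c * (K * Real.exp (-2 * c * (r - 1))) -
          ((N - a * Real.exp (-2 * x r) - N / 2 * (p r ^ 2 + p r * q r)) -
           (N - b * Real.exp (-2 * y r) - N / 2 * (q r ^ 2 + p r * q r))))
          + N / 2 * (p r + q r) * (K * Real.exp (-2 * c * (r - 1)) - (p r - q r)))) r := by
    intro r hr
    refine aux_E N x y (fun t => K * Real.exp (-2 * c * (t - 1)) - (p t - q t)) _ _ _ r
      (hx r hr) (hy r hr) ?_
    have h := (((((hasDerivAt_id r).sub_const 1).const_mul (-2 * c)).exp).const_mul K).sub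
      ((hp r hr).sub (hq r hr))
    refine h.congr_deriv ?_
    simp only [id]
    ring
  have h := aux_mono _ _ 1 t ht
    (fun r hr => (hd r (by linarith [hr.1])).continuousAt.continuousWithinAt)
    (fun r hr => hd r (by linarith [hr.1])) ?_
  · simp only [sub_self, mul_zero, Real.exp_zero, mul_one] at h
    have h2 : 0 ≤ Real.exp (N / 2 * (x 1 + y 1)) * (K - (p 1 - q 1)) :=
      mul_nonneg (Real.exp_pos _).le (by linarith)
    have h3 := nonneg_of_mul_nonneg_right (h2.trans h) (Real.exp_pos _)
    linarith
  · intro r hr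
    apply mul_nonneg (Real.exp_pos _).le
    have hg : 0 < Real.exp (-2 * c * (r - 1)) := Real.exp_pos _
    have hyg : Real.exp (-2 * y r) ≤ Real.exp (-2 * c * (r - 1)) :=
      Real.exp_le_exp.2 (by linarith [hyl r hr.1.le])
    have hxg : 0 < Real.exp (-2 * x r) := Real.exp_pos _
    have hyg0 : 0 < Real.exp (-2 * y r) := Real.exp_pos _
    have e1 := hpl r hr.1.le
    have e2 := hql r hr.1.le
    generalize Real.exp (-2 * c * (r - 1)) = g at *
    generalize Real.exp (-2 * x r) = gx at *
    generalize Real.exp (-2 * y r) = gy at *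
    have hKpos : 0 < K := by
      by_contra! hk
      nlinarith
    have f1 : b * gy ≤ N * g := by nlinarith
    have f2 : 3 * c ≤ N / 2 * (p r + q r) := by nlinarith
    have f3 : 3 * c * (K * g) ≤ N / 2 * (p r + q r) * (K * g) :=
      mul_le_mul_of_nonneg_right f2 (by positivity)
    have f4 : N * g ≤ K * c * g := mul_le_mul_of_nonneg_right hK hg.le
    have f5 : 0 < a * gx := by positivity
    nlinarith

theorem aux_core (N a b : ℝ) (x y p q : ℝ → ℝ) (hN : 3 ≤ N) (ha : 0 < a) (haN : a < N)
    (hb : 0 < b) (hbN : b < N)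
    (hxc : ContinuousOn x (Ici 0)) (hyc : ContinuousOn y (Ici 0))
    (hpc : ContinuousOn p (Ici 0)) (hqc : ContinuousOn q (Ici 0))
    (hx : ∀ t, 0 < t → HasDerivAt x (p t) t) (hy : ∀ t, 0 < t → HasDerivAt y (q t) t)
    (hp : ∀ t, 0 < t →
      HasDerivAt p (N - a * Real.exp (-2 * x t) - N / 2 * (p t ^ 2 + p t * q t)) t)
    (hq : ∀ t, 0 < t →
      HasDerivAt q (N - b * Real.exp (-2 * y t) - N / 2 * (q t ^ 2 + p t * q t)) t)
    (x0 : x 0 = 0) (y0 : y 0 = 0) (p0 : p 0 = 0) (q0 : q 0 = 0) :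
    ∃ L : ℝ, Filter.Tendsto (fun t => x t - y t) Filter.atTop (nhds L) := by
  have hq' : ∀ t, 0 < t →
      HasDerivAt q (N - b * Real.exp (-2 * y t) - N / 2 * (q t ^ 2 + q t * p t)) t := by
    intro t ht
    rw [mul_comm (q t) (p t)]
    exact hq t ht
  have hp' : ∀ t, 0 < t →
      HasDerivAt p (N - a * Real.exp (-2 * x t) - N / 2 * (p t ^ 2 + q t * p t)) t := by
    intro t ht
    rw [mul_comm (q t) (p t)]
    exact hp t ht
  have nx := aux_nonneg N a x y p q ha haN hxc hyc hpc hx hy hp x0 p0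
  have ny := aux_nonneg N b y x q p hb hbN hyc hxc hqc hy hx hq' y0 q0
  have hw : ∀ t, 0 ≤ t → p t + q t ≤ 2 := by
    intro t ht
    have h := aux_mono (fun t => Real.exp (N / 2 * (x t + y t)) *
        (Real.exp (N * t) * (2 - (p t + q t))))
      (fun r => Real.exp (N / 2 * (x r + y r)) *
        ((Real.exp (N * r) * (N * (2 - (p r + q r)) -
          ((N - a * Real.exp (-2 * x r) - N / 2 * (p r ^ 2 + p r * q r)) +
           (N - b * Real.exp (-2 * y r) - N / 2 * (q r ^ 2 + p r * q r)))))
          + N / 2 * (p r + q r) * (Real.exp (N * r) * (2 - (p r + q r))))) 0 t ht ?_ ?_ ?_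
    · simp only [x0, y0, p0, q0, add_zero, mul_zero, Real.exp_zero, sub_zero, one_mul] at h
      have h1 := nonneg_of_mul_nonneg_right (le_trans (by norm_num) h) (Real.exp_pos _)
      have h2 := nonneg_of_mul_nonneg_right h1 (Real.exp_pos _)
      linarith
    · have hs : Icc 0 t ⊆ Ici (0:ℝ) := Icc_subset_Ici_self
      exact ((continuousOn_const.mul ((hxc.mono hs).add (hyc.mono hs))).rexp).mul
        (((continuousOn_const.mul continuousOn_id).rexp).mul
          (continuousOn_const.sub ((hpc.mono hs).add (hqc.mono hs))))
    · intro r hr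
      refine aux_E N x y (fun t => Real.exp (N * t) * (2 - (p t + q t))) _ _ _ r
        (hx r hr.1) (hy r hr.1) ?_
      have h := (((hasDerivAt_id r).const_mul N).exp).mul
        (((hp r hr.1).add (hq r hr.1)).const_sub 2)
      refine h.congr_deriv ?_
      simp only [id, Pi.add_apply]
      ring
    · intro r hr
      apply mul_nonneg (Real.exp_pos _).le
      have e : Real.exp (N * r) * (N * (2 - (p r + q r)) -
          ((N - a * Real.exp (-2 * x r) - N / 2 * (p r ^ 2 + p r * q r)) +
           (N - b * Real.exp (-2 * y r) - N / 2 * (q r ^ 2 + p r * q r))))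
          + N / 2 * (p r + q r) * (Real.exp (N * r) * (2 - (p r + q r)))
          = Real.exp (N * r) * (a * Real.exp (-2 * x r) + b * Real.exp (-2 * y r)) := by ring
      rw [e]
      positivity
  obtain ⟨c, hc, hca, hcb⟩ : ∃ c : ℝ, 0 < c ∧ c * (2 * N) ≤ N - a ∧ c * (2 * N) ≤ N - b := by
    refine ⟨min (N - a) (N - b) / (2 * N), ?_, ?_, ?_⟩
    · exact div_pos (lt_min (by linarith) (by linarith)) (by linarith)
    · rw [div_mul_cancel₀ _ (by linarith)]; exact min_le_left _ _
    · rw [div_mul_cancel₀ _ (by linarith)]; exact min_le_right _ _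
  have lx := aux_lower N a c x p q hN ha haN hca hxc hpc hx hp (fun t ht => (nx t ht).1)
    (fun t ht => (nx t ht).2) hw p0
  have ly := aux_lower N b c y q p hN hb hbN hcb hyc hqc hy hq' (fun t ht => (ny t ht).1)
    (fun t ht => (ny t ht).2) (fun t ht => by linarith [hw t ht]) q0
  obtain ⟨K, hK, hK1, hK2⟩ : ∃ K : ℝ, N ≤ K * c ∧ p 1 - q 1 ≤ K ∧ q 1 - p 1 ≤ K := by
    refine ⟨N / c + |p 1 - q 1|, ?_, ?_, ?_⟩
    · rw [add_mul, div_mul_cancel₀ _ hc.ne']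
      nlinarith [abs_nonneg (p 1 - q 1)]
    · have := le_abs_self (p 1 - q 1)
      have : 0 < N / c := div_pos (by linarith) hc
      linarith
    · have := neg_abs_le (p 1 - q 1)
      have : 0 < N / c := div_pos (by linarith) hc
      linarith
  have d1 := aux_decay N a b c x y p q hN ha hb hbN hc hx hy hp hq (fun t ht => (lx t ht).1)
    (fun t ht => (ly t ht).1) (fun t ht => (ly t ht).2) K hK hK1
  have d2 := aux_decay N b a c y x q p hN hb ha haN hc hy hx hq' hp' (fun t ht => (ly t ht).1)
    (fun t ht => (lx t ht).1) (fun t ht => (lx t ht).2) K hK hK2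
  have hg : ∀ r, HasDerivAt (fun t => K / (2 * c) * Real.exp (-2 * c * (t - 1)))
      (-(K * Real.exp (-2 * c * (r - 1)))) r := by
    intro r
    have h := ((((hasDerivAt_id r).sub_const 1).const_mul (-2 * c)).exp).const_mul (K / (2 * c))
    refine h.congr_deriv ?_
    simp only [id]
    field_simp
  have hG : ∀ r t, 1 ≤ r → r ≤ t →
      x r - y r - K / (2 * c) * Real.exp (-2 * c * (r - 1)) ≤
      x t - y t - K / (2 * c) * Real.exp (-2 * c * (t - 1)) := by
    intro r t hr hrt
    have hd : ∀ u, r ≤ u → HasDerivAt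
        (fun t => x t - y t - K / (2 * c) * Real.exp (-2 * c * (t - 1)))
        (p u - q u - -(K * Real.exp (-2 * c * (u - 1)))) u := fun u hu =>
      ((hx u (by linarith)).sub (hy u (by linarith))).sub (hg u)
    refine aux_mono _ _ r t hrt
      (fun u hu => (hd u hu.1).continuousAt.continuousWithinAt) (fun u hu => hd u hu.1.le) ?_
    intro u hu
    linarith [d2 u (by linarith [hu.1])]
  have hH : ∀ t, 1 ≤ t →
      x t - y t + K / (2 * c) * Real.exp (-2 * c * (t - 1)) ≤ x 1 - y 1 + K / (2 * c) := by
    intro t ht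
    have hd : ∀ u, 1 ≤ u → HasDerivAt
        (fun t => y t - x t - K / (2 * c) * Real.exp (-2 * c * (t - 1)))
        (q u - p u - -(K * Real.exp (-2 * c * (u - 1)))) u := fun u hu =>
      ((hy u (by linarith)).sub (hx u (by linarith))).sub (hg u)
    have h := aux_mono _ _ 1 t ht
      (fun u hu => (hd u hu.1).continuousAt.continuousWithinAt) (fun u hu => hd u hu.1.le) (by
        intro u hu
        linarith [d1 u hu.1.le])
    simp only [sub_self, mul_zero, Real.exp_zero, mul_one] at h
    linarith
  have hKpos : 0 < K := by
    by_contra! hk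
    nlinarith
  -- the monotone function on all of `ℝ`
  let G : ℝ → ℝ := fun t => x t - y t - K / (2 * c) * Real.exp (-2 * c * (t - 1))
  have hmono : Monotone (fun t => G (max 1 t)) := by
    intro r t hrt
    exact hG _ _ (le_max_left _ _) (max_le_max le_rfl hrt)
  have hbdd : BddAbove (range (fun t => G (max 1 t))) := by
    refine ⟨x 1 - y 1 + K / (2 * c), ?_⟩
    rintro _ ⟨t, rfl⟩
    have h1 := hH (max 1 t) (le_max_left _ _)
    have h2 : 0 < K / (2 * c) * Real.exp (-2 * c * (max 1 t - 1)) := by positivity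
    simp only [G]
    linarith
  have hlim := tendsto_atTop_ciSup hmono hbdd
  have hlim2 : Tendsto G atTop (nhds (⨆ t, G (max 1 t))) := by
    refine hlim.congr' ?_
    filter_upwards [eventually_ge_atTop 1] with t ht
    rw [max_eq_right ht]
  have hexp : Tendsto (fun t => Real.exp (-2 * c * (t - 1))) atTop (nhds 0) := by
    apply Real.tendsto_exp_atBot.comp
    apply Tendsto.const_mul_atTop_of_neg (by linarith)
    exact tendsto_atTop_add_const_right _ (-1) tendsto_id
  refine ⟨_, (hlim2.add (hexp.const_mul (K / (2 * c)))).congr ?_⟩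
  · intro t
    simp only [G]
    ring

/-- For `n ≥ 3` and `(n−1)/n < s < (n−1)/(n−2)`, along a global solution of `(S_s)` with
zero initial data the limit `lim_{t→∞} (x(t) − y(t))` exists (and is finite). -/
theorem limit_of_difference_exists
    (n : ℕ) (hn : 3 ≤ n) (s : ℝ)
    (hs1 : ((n : ℝ) - 1) / (n : ℝ) < s) (hs2 : s < ((n : ℝ) - 1) / ((n : ℝ) - 2))
    (x y : ℝ → ℝ)
    (hx : ContDiffOn ℝ 2 x (Ici (0 : ℝ))) (hy : ContDiffOn ℝ 2 y (Ici (0 : ℝ)))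
    (hsys : SysS n s x y (Ici (0 : ℝ))) (hinit : ZeroInit x y) :
    ∃ L : ℝ, Filter.Tendsto (fun t => x t - y t) Filter.atTop (nhds L) := by
  have hN : (3 : ℝ) ≤ (n : ℝ) := by exact_mod_cast hn
  obtain ⟨x0, y0, p0, q0⟩ := hinit
  have hs0 : 0 < s := lt_trans (div_pos (by linarith) (by linarith)) hs1
  have hinv : s * (1 / s) = 1 := by field_simp
  rw [div_lt_iff₀ (by linarith)] at hs1
  rw [lt_div_iff₀ (by linarith)] at hs2
  have ha : 0 < (1 / s) * ((n : ℝ) - 1) := mul_pos (by positivity) (by linarith)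
  have haN : (1 / s) * ((n : ℝ) - 1) < n := by
    rw [one_div, inv_mul_lt_iff₀ hs0]
    linarith
  have ha2 : (n : ℝ) - 2 < (1 / s) * ((n : ℝ) - 1) := by
    rw [one_div, lt_inv_mul_iff₀ hs0]
    linarith
  have hb : 0 < (2 - 1 / s) * ((n : ℝ) - 1) := by nlinarith
  have hbN : (2 - 1 / s) * ((n : ℝ) - 1) < n := by nlinarith
  have hz := hsys 0 (mem_Ici.2 le_rfl)
  simp only [x0, y0, p0, q0, mul_zero, Real.exp_zero, mul_one] at hz
  obtain ⟨hxc, hpc, hxd, hpd⟩ := aux_reg x hx (by rw [hz.1]; apply ne_of_gt; norm_num at *; linarith)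
  obtain ⟨hyc, hqc, hyd, hqd⟩ := aux_reg y hy (by rw [hz.2]; apply ne_of_gt; norm_num at *; linarith)
  exact aux_core n _ _ x y (deriv x) (deriv y) hN ha haN hb hbN hxc hyc hpc hqc hxd hyd
    (fun t ht => (hsys t (mem_Ici.2 ht.le)).1 ▸ hpd t ht)
    (fun t ht => (hsys t (mem_Ici.2 ht.le)).2 ▸ hqd t ht) x0 y0 p0 q0
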